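/- Let W be a real vector space of finite dimension m ≥ 1 and F a Minkowski norm on W, extended continuously by F(0) = 0. Define G : ℝ × W → ℝ by G(t,w) := t² − F(w)². Then G is continuous on ℝ × W and positively 2-homogeneous, G is smooth (C^∞) at every point (t,w) with w ≠ 0, and at every such point its fundamental tensor, which is given by g_{(t,w)}((s,u),(s',u')) = s·s' − ĝ_w(u,u') where ĝ is the fundamental tensor of F², is nondegenerate with index m. -/

import Mathlib

open Set Module

noncomputable section

variable {W : Type*} [NormedAddCommGroup W] [NormedSpace ℝ W]

/-- Positively 1-homogeneous on a set. -/
def PosHom1 (F : W → ℝ) (s : Set W) : Prop :=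
  ∀ v ∈ s, ∀ c : ℝ, 0 < c → F (c • v) = c * F v

/-- The fundamental tensor of `L` at `v`: `g_v(u,w) = (1/2) D²L(v)(u,w)`. -/
def fundTensor {E : Type*} [NormedAddCommGroup E] [NormedSpace ℝ E]
    (L : E → ℝ) (v u w : E) : ℝ :=
  (1 / 2 : ℝ) * fderiv ℝ (fderiv ℝ L) v u w

/-- Nondegenerate with index `m` on an `(m+1)`-dimensional space: nondegenerate and
negative definite on some subspace of dimension `m`. -/
def IsLorentzIdx {E : Type*} [NormedAddCommGroup E] [NormedSpace ℝ E]
    (g : E → E → ℝ) (m : ℕ) : Prop :=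
  (∀ u : E, (∀ w : E, g u w = 0) → u = 0) ∧
  ∃ S : Submodule ℝ E, finrank ℝ S = m ∧ ∀ u ∈ S, u ≠ 0 → g u u < 0

/-- A Minkowski norm on `W`. -/
structure IsMinkowskiNorm (F : W → ℝ) : Prop where
  pos : ∀ v : W, v ≠ 0 → 0 < F v
  smooth : ContDiffOn ℝ (⊤ : ℕ∞) F {0}ᶜ
  hom : PosHom1 F {0}ᶜ
  posdef : ∀ v : W, v ≠ 0 → ∀ u : W, u ≠ 0 →
    0 < fundTensor (fun x => F x ^ 2) v u u

/-- A positively 1-homogeneous function that is continuous away from `0` and vanishes at `0` is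
continuous. -/
theorem PosHom1.continuous [FiniteDimensional ℝ W] {F : W → ℝ} (hF : PosHom1 F {0}ᶜ)
    (hc : ContinuousOn F {0}ᶜ) (hF0 : F 0 = 0) : Continuous F := by
  have hsub : Metric.sphere (0 : W) 1 ⊆ {0}ᶜ := fun x hx h => by
    rw [mem_singleton_iff.1 h] at hx
    simp at hx
  obtain ⟨C, hC⟩ := (isCompact_sphere (0 : W) 1).exists_bound_of_continuousOn (hc.mono hsub)
  have hbound : ∀ v : W, ‖F v‖ ≤ C * ‖v‖ := fun v => by
    by_cases hv : v = 0
    · simp [hv, hF0]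
    have hpos : 0 < ‖v‖ := norm_pos_iff.2 hv
    have hmem : ‖v‖⁻¹ • v ∈ Metric.sphere (0 : W) 1 := by
      simp [norm_smul, hpos.ne']
    have hscale : F v = ‖v‖ * F (‖v‖⁻¹ • v) := by
      rw [← hF _ (hsub hmem) _ hpos, smul_inv_smul₀ hpos.ne']
    rw [hscale, norm_mul, norm_norm, mul_comm]
    exact mul_le_mul_of_nonneg_right (hC _ hmem) hpos.le
  refine continuous_iff_continuousAt.2 fun v => ?_
  by_cases hv : v = 0
  · subst hv
    rw [ContinuousAt, hF0]
    refine squeeze_zero_norm hbound ?_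
    have h : Continuous fun v : W => C * ‖v‖ := by fun_prop
    simpa using h.tendsto 0
  · exact hc.continuousAt (isOpen_compl_singleton.mem_nhds hv)

/-- The fundamental tensor of `(t, w) ↦ t² - f w`. -/
theorem fundTensor_sq_fst_sub {f : W → ℝ} {p : ℝ × W} (hf : ContDiffAt ℝ 2 f p.2)
    (u u' : ℝ × W) :
    fundTensor (fun q : ℝ × W => q.1 ^ 2 - f q.2) p u u' =
      u.1 * u'.1 - fundTensor f p.2 u.2 u'.2 := by
  have hfst : ∀ q : ℝ × W, HasFDerivAt (fun q : ℝ × W => q.1 ^ 2)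
      ((2 * q.1) • ContinuousLinearMap.fst ℝ ℝ W) q := fun q => by
    simpa using (hasFDerivAt_fst (𝕜 := ℝ) (p := q)).pow 2
  have hev : fderiv ℝ (fun q : ℝ × W => q.1 ^ 2 - f q.2) =ᶠ[nhds p] fun q =>
      (2 * q.1) • ContinuousLinearMap.fst ℝ ℝ W -
        (fderiv ℝ f q.2).comp (ContinuousLinearMap.snd ℝ ℝ W) := by
    have hdiff : ∀ᶠ w in nhds p.2, DifferentiableAt ℝ f w :=
      (hf.eventually (by simp)).mono fun w hw => hw.differentiableAt (by simp)
    filter_upwards [continuous_snd.continuousAt.eventually hdiff] with q hq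
    exact ((hfst q).sub (hq.hasFDerivAt.comp q hasFDerivAt_snd)).fderiv
  have hd : DifferentiableAt ℝ (fderiv ℝ f) p.2 :=
    (hf.fderiv_right (m := 1) (by norm_num)).differentiableAt (by simp)
  have hlin : HasFDerivAt (fun q : ℝ × W => (2 * q.1) • ContinuousLinearMap.fst ℝ ℝ W)
      (((2 : ℝ) • ContinuousLinearMap.fst ℝ ℝ W).smulRight (ContinuousLinearMap.fst ℝ ℝ W)) p :=
    (((2 : ℝ) • ContinuousLinearMap.fst ℝ ℝ W).smulRight
      (ContinuousLinearMap.fst ℝ ℝ W)).hasFDerivAt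
  have hcomp := ((ContinuousLinearMap.compL ℝ (ℝ × W) W ℝ).flip
    (ContinuousLinearMap.snd ℝ ℝ W)).hasFDerivAt.comp p
      (hd.hasFDerivAt.comp p hasFDerivAt_snd)
  have hsecond := (hlin.sub hcomp).congr_of_eventuallyEq hev
  rw [fundTensor, fundTensor, hsecond.fderiv]
  simp
  ring

/-- The product form `s * s' - b u u'` has Lorentzian index when `b` is positive definite. -/
theorem isLorentzIdx_of_posDef {g : ℝ × W → ℝ × W → ℝ} {b : W → W → ℝ}
    (hg : ∀ u u', g u u' = u.1 * u'.1 - b u.2 u'.2) (hb0 : ∀ u, b u 0 = 0)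
    (hb : ∀ u, u ≠ 0 → 0 < b u u) : IsLorentzIdx g (finrank ℝ W) := by
  refine ⟨fun u hu => ?_, LinearMap.range (LinearMap.inr ℝ ℝ W),
    LinearMap.finrank_range_of_inj LinearMap.inr_injective, ?_⟩
  · have h1 : u.1 = 0 := by simpa [hg, hb0] using hu (u.1, 0)
    have h2 : u.2 = 0 := by
      by_contra hne
      have h := hu (0, u.2)
      rw [hg] at h
      simp only [mul_zero, zero_sub, neg_eq_zero] at h
      exact (hb _ hne).ne' h
    exact Prod.ext h1 h2
  · rintro _ ⟨w, rfl⟩ hne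
    have hw : w ≠ 0 := by
      rintro rfl
      simp at hne
    simpa [hg] using hb w hw

/-- the continuous Lorentz-Finsler function `G(t,w) = t² - F(w)²`
associated with a Minkowski norm `F`. -/
theorem stmt_5 [FiniteDimensional ℝ W] (hm : 1 ≤ finrank ℝ W)
    (F : W → ℝ) (hF : IsMinkowskiNorm F) (hF0 : F 0 = 0)
    (G : ℝ × W → ℝ) (hGdef : ∀ p : ℝ × W, G p = p.1 ^ 2 - F p.2 ^ 2) :
    Continuous G ∧
    (∀ p : ℝ × W, ∀ c : ℝ, 0 < c → G (c • p) = c ^ 2 * G p) ∧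
    (∀ p : ℝ × W, p.2 ≠ 0 → ContDiffAt ℝ (⊤ : ℕ∞) G p) ∧
    (∀ p : ℝ × W, p.2 ≠ 0 →
      (∀ u u' : ℝ × W, fundTensor G p u u' =
        u.1 * u'.1 - fundTensor (fun x => F x ^ 2) p.2 u.2 u'.2) ∧
      IsLorentzIdx (fundTensor G p) (finrank ℝ W)) := by
  obtain rfl : G = fun p => p.1 ^ 2 - F p.2 ^ 2 := funext hGdef
  have hFsmooth : ∀ w : W, w ≠ 0 → ContDiffAt ℝ (⊤ : ℕ∞) F w := fun w hw =>
    hF.smooth.contDiffAt (isOpen_compl_singleton.mem_nhds hw)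
  have hFc : Continuous F := hF.hom.continuous hF.smooth.continuousOn hF0
  refine ⟨by fun_prop, fun p c hc => ?_, fun p hp => ?_, fun p hp => ?_⟩
  · have hhom : F (c • p.2) = c * F p.2 := by
      by_cases hp : p.2 = 0
      · simp [hp, hF0]
      · exact hF.hom _ hp c hc
    simp only [Prod.smul_fst, Prod.smul_snd, smul_eq_mul, hhom]
    ring
  · exact (contDiffAt_fst.pow 2).sub (((hFsmooth _ hp).comp p contDiffAt_snd).pow 2)
  · have htensor := fundTensor_sq_fst_sub (p := p) (f := fun x => F x ^ 2)
      (((hFsmooth _ hp).pow 2).of_le (WithTop.coe_le_coe.2 le_top))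
    exact ⟨htensor, isLorentzIdx_of_posDef htensor (fun u => by simp [fundTensor])
      (hF.posdef _ hp)⟩
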